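/- Weighted bound for I₁ on the unit disk with L^p weight, p > 2: For every p > 2 there is a constant C_p depending only on p such that for every measurable weight V : D₁ → (0,∞) with V ∈ L^p(D₁) and every measurable f : D₁ → [0,∞) with ∫_{D₁} f(z)² V(z)^{−1} dv_z < ∞, one has ∫_{D₁} (∫_{D₁} f(ζ)/|ζ−z| dv_ζ)² V(z) dv_z ≤ C_p² (∫_{D₁} V^p dv)^{2/p} ∫_{D₁} f(z)² V(z)^{−1} dv_z; that is, ‖I₁f‖_{L²_V(D₁)} ≤ C_p ‖V‖_{L^p(D₁)} ‖f‖_{L²_{V^{−1}}(D₁)}. -/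

import Mathlib

open MeasureTheory Metric
open scoped ENNReal

/-- **Weighted Schur test.** A symmetric kernel `k` with `∫ w(ζ) k(ζ, z) dζ ≤ M` for almost every
`z` maps `√(w g)` into `L²(w)` with norm at most `M ‖g‖₁^{1/2}`. -/
theorem lintegral_sq_kernel_sqrt_mul_le {α : Type*} [MeasurableSpace α] {μ : Measure α} [SFinite μ]
    {k : α → α → ℝ≥0∞} (hk : Measurable (Function.uncurry k)) (hsymm : ∀ x y, k x y = k y x)
    {w g : α → ℝ≥0∞} (hw : Measurable w) (hg : Measurable g) {M : ℝ≥0∞}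
    (hM : ∀ᵐ z ∂μ, ∫⁻ ζ, w ζ * k ζ z ∂μ ≤ M) :
    ∫⁻ z, (∫⁻ ζ, (w ζ * k ζ z) ^ (1 / 2 : ℝ) * (g ζ * k ζ z) ^ (1 / 2 : ℝ) ∂μ) ^ 2 * w z ∂μ
      ≤ M ^ 2 * ∫⁻ z, g z ∂μ := by
  have hk_left (z : α) : Measurable fun ζ => k ζ z := hk.comp measurable_prodMk_right
  have hswap : Measurable fun x : α × α => k x.2 x.1 := hk.comp measurable_swap
  have sq_half (a : ℝ≥0∞) : (a ^ (1 / 2 : ℝ)) ^ 2 = a := by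
    rw [← ENNReal.rpow_natCast, ← ENNReal.rpow_mul]
    norm_num
  calc
    _ ≤ ∫⁻ z, M * (∫⁻ ζ, g ζ * k ζ z ∂μ) * w z ∂μ := by
        refine lintegral_mono_ae ?_
        filter_upwards [hM] with z hz
        gcongr
        calc
          _ ≤ ((∫⁻ ζ, w ζ * k ζ z ∂μ) ^ (1 / 2 : ℝ) *
                (∫⁻ ζ, g ζ * k ζ z ∂μ) ^ (1 / 2 : ℝ)) ^ 2 := by
              gcongr
              exact ENNReal.lintegral_mul_norm_pow_le (hw.mul (hk_left z)).aemeasurable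
                (hg.mul (hk_left z)).aemeasurable (by norm_num) (by norm_num) (by norm_num)
          _ = (∫⁻ ζ, w ζ * k ζ z ∂μ) * ∫⁻ ζ, g ζ * k ζ z ∂μ := by
              rw [mul_pow, sq_half, sq_half]
          _ ≤ _ := by gcongr
    _ = ∫⁻ z, ∫⁻ ζ, M * (g ζ * k ζ z) * w z ∂μ ∂μ := by
        refine lintegral_congr fun z => ?_
        have hgk : Measurable fun ζ => g ζ * k ζ z := hg.mul (hk_left z)
        rw [← lintegral_const_mul _ hgk, ← lintegral_mul_const _ (hgk.const_mul M)]
    _ = ∫⁻ ζ, ∫⁻ z, M * (g ζ * k ζ z) * w z ∂μ ∂μ := by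
        refine lintegral_lintegral_swap (Measurable.aemeasurable ?_)
        exact (((hg.comp measurable_snd).mul hswap).const_mul M).mul (hw.comp measurable_fst)
    _ = ∫⁻ ζ, M * g ζ * ∫⁻ z, w z * k z ζ ∂μ ∂μ := by
        refine lintegral_congr fun ζ => ?_
        have hwk : Measurable fun z => w z * k z ζ := hw.mul (hk_left ζ)
        rw [← lintegral_const_mul _ hwk]
        refine lintegral_congr fun z => ?_
        rw [hsymm ζ z]
        ring
    _ ≤ ∫⁻ ζ, M * g ζ * M ∂μ := by
        refine lintegral_mono_ae ?_
        filter_upwards [hM] with ζ hζ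
        gcongr
    _ = M ^ 2 * ∫⁻ z, g z ∂μ := by
        rw [lintegral_mul_const _ (hg.const_mul M), lintegral_const_mul _ hg]
        ring

/-- In the plane, `|ζ - z|^{-q}` with `0 ≤ q < 2` is integrable over the unit disk uniformly in
`z` in the unit disk. -/
theorem exists_lintegral_ball_inv_dist_rpow_le {q : ℝ} (hq0 : 0 ≤ q) (hq : q < 2) :
    ∃ B : ℝ≥0∞, B ≠ ⊤ ∧ ∀ z ∈ ball (0 : ℂ) 1,
      ∫⁻ ζ in ball (0 : ℂ) 1, ENNReal.ofReal (1 / dist ζ z) ^ q ≤ B := by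
  have hint : IntegrableOn (fun w : ℂ => ‖w‖ ^ (-q)) (ball 0 2) := by
    refine integrableOn_ball_of_norm_le_rpow (C := 1) (α := q) (by simp) (by simpa using hq)
      (Filter.Eventually.of_forall fun w => ?_) (Measurable.aestronglyMeasurable (by fun_prop))
    rw [one_mul, Real.norm_of_nonneg (by positivity)]
  refine ⟨∫⁻ w in ball (0 : ℂ) 2, ENNReal.ofReal (‖w‖ ^ (-q)), hint.lintegral_lt_top.ne,
    fun z hz => ?_⟩
  calc
    _ ≤ ∫⁻ ζ in ball z 2, ENNReal.ofReal (1 / dist ζ z) ^ q := by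
        refine lintegral_mono_set (ball_subset_ball' ?_)
        rw [dist_comm]
        linarith [mem_ball.1 hz]
    _ = ∫⁻ ζ, (ball (0 : ℂ) 2).indicator (fun w => ENNReal.ofReal (‖w‖ ^ (-q))) (ζ - z) := by
        rw [← lintegral_indicator measurableSet_ball]
        refine lintegral_congr fun ζ => ?_
        have hmem : ζ ∈ ball z 2 ↔ ζ - z ∈ ball (0 : ℂ) 2 := by
          simp [dist_eq_norm]
        by_cases h : ζ ∈ ball z 2
        · rw [Set.indicator_of_mem h, Set.indicator_of_mem (hmem.1 h),
            ENNReal.ofReal_rpow_of_nonneg (by positivity) hq0, dist_eq_norm, one_div,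
            Real.inv_rpow (norm_nonneg _), Real.rpow_neg (norm_nonneg _)]
        · rw [Set.indicator_of_notMem h, Set.indicator_of_notMem (mt hmem.2 h)]
    _ = _ := by
        rw [lintegral_sub_right_eq_self, lintegral_indicator measurableSet_ball]

/-- **Weighted bound for `I₁` on the unit disk with `L^p` weight, `p > 2`.**
For every `p > 2` there is a constant `C_p > 0`, depending only on `p`, such that for every
measurable weight `V : D₁ → (0,∞)` with `V ∈ L^p(D₁)` and every measurable nonnegative `f`
with `∫_{D₁} f² V⁻¹ < ∞`,
`∫_{D₁} (∫_{D₁} f(ζ)/|ζ−z| dζ)² V(z) dz ≤ C_p² (∫_{D₁} V^p)^{2/p} (∫_{D₁} f² V⁻¹)`,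
i.e. `‖I₁ f‖_{L²_V(D₁)} ≤ C_p ‖V‖_{L^p(D₁)} ‖f‖_{L²_{V⁻¹}(D₁)}`. -/
theorem weighted_bound_I1_unit_disk_Lp_weight (p : ℝ) (hp : 2 < p) :
    ∃ C : ℝ, 0 < C ∧
      ∀ (V f : ℂ → ℝ), Measurable V → (∀ z, 0 < V z) → Measurable f → (∀ z, 0 ≤ f z) →
        (∫⁻ z in ball (0 : ℂ) 1, ENNReal.ofReal (V z ^ p)) < ⊤ →
        (∫⁻ z in ball (0 : ℂ) 1, ENNReal.ofReal (f z ^ 2 / V z)) < ⊤ →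
        ∫⁻ z in ball (0 : ℂ) 1,
            (∫⁻ ζ in ball (0 : ℂ) 1, ENNReal.ofReal (f ζ / dist ζ z)) ^ 2 *
              ENNReal.ofReal (V z)
          ≤ ENNReal.ofReal (C ^ 2) *
              (∫⁻ z in ball (0 : ℂ) 1, ENNReal.ofReal (V z ^ p)) ^ (2 / p) *
              (∫⁻ z in ball (0 : ℂ) 1, ENNReal.ofReal (f z ^ 2 / V z)) := by
  obtain ⟨q, hpq⟩ : ∃ q, p.HolderConjugate q :=
    ⟨_, Real.HolderConjugate.conjExponent (by linarith)⟩
  have hq : q < 2 := by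
    rw [hpq.conjugate_eq, div_lt_iff₀ (by linarith)]
    linarith
  obtain ⟨B, hB, hBle⟩ := exists_lintegral_ball_inv_dist_rpow_le hpq.symm.nonneg hq
  have hA : B ^ (1 / q) ≠ ⊤ := ENNReal.rpow_ne_top_of_nonneg (by simpa using hpq.symm.nonneg) hB
  refine ⟨(B ^ (1 / q)).toReal + 1, by positivity, fun V f hV hVpos hf hf0 _ _ => ?_⟩
  set C : ℝ := (B ^ (1 / q)).toReal + 1
  set N : ℝ≥0∞ := ∫⁻ z in ball (0 : ℂ) 1, ENNReal.ofReal (V z ^ p)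
  have hC0 : 0 ≤ C := by positivity
  have hAC : B ^ (1 / q) ≤ ENNReal.ofReal C := by
    rw [← ENNReal.ofReal_toReal hA]
    exact ENNReal.ofReal_le_ofReal (by simp [C])
  have hk : Measurable (Function.uncurry fun ζ z : ℂ => ENNReal.ofReal (1 / dist ζ z)) := by
    unfold Function.uncurry
    fun_prop
  have hM : ∀ᵐ z ∂(volume.restrict (ball (0 : ℂ) 1)),
      ∫⁻ ζ in ball (0 : ℂ) 1, ENNReal.ofReal (V ζ) * ENNReal.ofReal (1 / dist ζ z)
        ≤ N ^ (1 / p) * ENNReal.ofReal C := by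
    filter_upwards [self_mem_ae_restrict measurableSet_ball] with z hz
    refine (ENNReal.lintegral_mul_le_Lp_mul_Lq _ hpq
      hV.ennreal_ofReal.aemeasurable (Measurable.aemeasurable (by fun_prop))).trans ?_
    gcongr
    · refine le_of_eq (lintegral_congr fun ζ => ?_)
      rw [ENNReal.ofReal_rpow_of_pos (hVpos ζ)]
    · refine le_trans ?_ hAC
      have := hpq.symm.nonneg
      gcongr
      exact hBle z hz
  have hfactor (ζ z : ℂ) : ENNReal.ofReal (f ζ / dist ζ z) =
      (ENNReal.ofReal (V ζ) * ENNReal.ofReal (1 / dist ζ z)) ^ (1 / 2 : ℝ) *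
        (ENNReal.ofReal (f ζ ^ 2 / V ζ) * ENNReal.ofReal (1 / dist ζ z)) ^ (1 / 2 : ℝ) := by
    have hVζ := hVpos ζ
    have hsq : V ζ * (1 / dist ζ z) * (f ζ ^ 2 / V ζ * (1 / dist ζ z)) =
        (f ζ / dist ζ z) ^ 2 := by
      field_simp
    rw [← ENNReal.mul_rpow_of_nonneg _ _ (by norm_num), ← ENNReal.ofReal_mul hVζ.le,
      ← ENNReal.ofReal_mul (by positivity), ← ENNReal.ofReal_mul (by positivity), hsq,
      ENNReal.ofReal_rpow_of_nonneg (by positivity) (by norm_num), ← Real.sqrt_eq_rpow,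
      Real.sqrt_sq (div_nonneg (hf0 ζ) dist_nonneg)]
  simp_rw [hfactor]
  refine (lintegral_sq_kernel_sqrt_mul_le hk (fun x y => by rw [dist_comm])
    hV.ennreal_ofReal (Measurable.ennreal_ofReal (by fun_prop)) hM).trans_eq ?_
  rw [mul_pow, ← ENNReal.rpow_natCast (N ^ (1 / p)), ← ENNReal.rpow_mul,
    ← ENNReal.ofReal_pow hC0, mul_comm (N ^ _)]
  congr 3
  push_cast
  ring
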